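/- For all complex numbers a, b with a ≠ 0, b ≠ 0 and |ab| < 1, the Ramanujan general theta function f(a,b) = ∑_{m∈ℤ} a^{m(m+1)/2} b^{m(m−1)/2} satisfies the product representation f(a,b) = ∏_{n=0}^∞ (1 + a(ab)^n) · ∏_{n=0}^∞ (1 + b(ab)^n) · ∏_{n=1}^∞ (1 − (ab)^n). -/

import Mathlib

open Filter Topology Finset

/-- The general term of the Ramanujan theta series. -/
noncomputable def ramanujanThetaTerm (a b : ℂ) (m : ℤ) : ℂ :=
  a ^ (m * (m + 1) / 2) * b ^ (m * (m - 1) / 2)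

/-- The finite `q`-Pochhammer symbol `(q;q)_n`. -/
noncomputable def qFactorial (q : ℂ) (n : ℕ) : ℂ := ∏ i ∈ range n, (1 - q ^ (i + 1))

/-- The reciprocal `1 / (q;q)_k` for integers `k`, which vanishes for `k < 0`. -/
noncomputable def qFactorialInv (q : ℂ) (k : ℤ) : ℂ :=
  if 0 ≤ k then (qFactorial q k.toNat)⁻¹ else 0

lemma ramanujanThetaTerm_add_one {a b : ℂ} (ha : a ≠ 0) (hb : b ≠ 0) (m : ℤ) :
    ramanujanThetaTerm a b (m + 1) = ramanujanThetaTerm a b m * (a * (a * b) ^ m) := by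
  have h₁ : (m + 1) * (m + 1 + 1) / 2 = m * (m + 1) / 2 + (m + 1) := by
    rw [← Int.add_mul_ediv_right _ _ two_ne_zero]; ring_nf
  have h₂ : (m + 1) * (m + 1 - 1) / 2 = m * (m - 1) / 2 + m := by
    rw [← Int.add_mul_ediv_right _ _ two_ne_zero]; ring_nf
  rw [ramanujanThetaTerm, ramanujanThetaTerm, h₁, h₂, zpow_add₀ ha, zpow_add₀ hb, zpow_add_one₀ ha,
    mul_zpow]
  ring

lemma ramanujanThetaTerm_ne_zero {a b : ℂ} (ha : a ≠ 0) (hb : b ≠ 0) (m : ℤ) :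
    ramanujanThetaTerm a b m ≠ 0 :=
  mul_ne_zero (zpow_ne_zero _ ha) (zpow_ne_zero _ hb)

lemma ramanujanThetaTerm_neg (a b : ℂ) (m : ℤ) :
    ramanujanThetaTerm a b (-m) = ramanujanThetaTerm b a m := by
  rw [ramanujanThetaTerm, ramanujanThetaTerm, mul_comm,
    show -m * (-m - 1) = m * (m + 1) by ring, show -m * (-m + 1) = m * (m - 1) by ring]

lemma summable_ramanujanThetaTerm_natCast {a b : ℂ} (ha : a ≠ 0) (hb : b ≠ 0)
    (hab : ‖a * b‖ < 1) : Summable fun n : ℕ ↦ ramanujanThetaTerm a b n := by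
  refine summable_of_ratio_test_tendsto_lt_one zero_lt_one
    (.of_forall fun n ↦ ramanujanThetaTerm_ne_zero ha hb n) ?_
  have h : Tendsto (fun n : ℕ ↦ ‖a * (a * b) ^ n‖) atTop (𝓝 0) := by
    simpa using ((tendsto_pow_atTop_nhds_zero_of_norm_lt_one hab).const_mul a).norm
  refine h.congr fun n ↦ ?_
  rw [← norm_div]
  push_cast
  rw [ramanujanThetaTerm_add_one ha hb, mul_div_cancel_left₀ _ (ramanujanThetaTerm_ne_zero ha hb _),
    zpow_natCast]

lemma summable_ramanujanThetaTerm {a b : ℂ} (ha : a ≠ 0) (hb : b ≠ 0) (hab : ‖a * b‖ < 1) :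
    Summable (ramanujanThetaTerm a b) := by
  refine .of_nat_of_neg (summable_ramanujanThetaTerm_natCast ha hb hab) ?_
  simp_rw [ramanujanThetaTerm_neg]
  exact summable_ramanujanThetaTerm_natCast hb ha (by rwa [mul_comm])

lemma one_sub_pow_succ_ne_zero {q : ℂ} (hq : ‖q‖ < 1) (n : ℕ) : 1 - q ^ (n + 1) ≠ 0 := by
  intro h
  have h₁ : ‖q ^ (n + 1)‖ = 1 := by rw [← sub_eq_zero.mp h, norm_one]
  rw [norm_pow] at h₁
  exact (pow_lt_one₀ (norm_nonneg q) hq n.succ_ne_zero).ne h₁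

lemma qFactorial_succ (q : ℂ) (n : ℕ) :
    qFactorial q (n + 1) = qFactorial q n * (1 - q ^ (n + 1)) :=
  prod_range_succ _ _

lemma qFactorialInv_sub_one {q : ℂ} (hq : ‖q‖ < 1) (k : ℤ) :
    qFactorialInv q (k - 1) = (1 - q ^ k) * qFactorialInv q k := by
  rcases lt_trichotomy k 0 with hk | rfl | hk
  · simp [qFactorialInv, hk.not_ge, show ¬ 1 ≤ k by lia]
  · simp [qFactorialInv]
  · obtain ⟨n, rfl⟩ : ∃ n : ℕ, k = n + 1 := ⟨(k - 1).toNat, by lia⟩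
    have h := one_sub_pow_succ_ne_zero hq n
    rw [qFactorialInv, qFactorialInv, if_pos (by lia), if_pos (by lia),
      show ((n : ℤ) + 1 - 1).toNat = n by lia, show ((n : ℤ) + 1).toNat = n + 1 by lia,
      qFactorial_succ, mul_inv, show q ^ ((n : ℤ) + 1) = q ^ (n + 1) by exact_mod_cast rfl]
    field_simp

lemma tendsto_qFactorial {q : ℂ} (hq : ‖q‖ < 1) :
    Tendsto (qFactorial q) atTop (𝓝 (∏' n : ℕ, (1 - q ^ (n + 1)))) :=
  (ModularForm.multipliable_one_sub_pow hq).hasProd.tendsto_prod_nat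

lemma tprod_one_sub_pow_succ_ne_zero {q : ℂ} (hq : ‖q‖ < 1) :
    ∏' n : ℕ, (1 - q ^ (n + 1)) ≠ 0 := by
  simp_rw [sub_eq_add_neg]
  refine tprod_one_add_ne_zero_of_summable (fun n ↦ ?_) ?_
  · simpa [sub_eq_add_neg] using one_sub_pow_succ_ne_zero hq n
  · simpa using (summable_nat_add_iff 1).mpr (summable_geometric_of_lt_one (norm_nonneg _) hq)

lemma tendsto_qFactorialInv {q : ℂ} (hq : ‖q‖ < 1) :
    Tendsto (qFactorialInv q) atTop (𝓝 (∏' n : ℕ, (1 - q ^ (n + 1)))⁻¹) := by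
  have h := ((tendsto_qFactorial hq).inv₀ (tprod_one_sub_pow_succ_ne_zero hq)).comp
    (tendsto_atTop_atTop.mpr fun n : ℕ ↦ ⟨n, fun k hk ↦ by lia⟩ : Tendsto Int.toNat atTop atTop)
  refine h.congr' ?_
  filter_upwards [eventually_ge_atTop 0] with k hk
  simp [qFactorialInv, hk]

lemma exists_norm_qFactorial_le {q : ℂ} (hq : ‖q‖ < 1) : ∃ C, ∀ n, ‖qFactorial q n‖ ≤ C := by
  simpa using (Metric.isBounded_range_of_tendsto _ (tendsto_qFactorial hq)).exists_norm_le

lemma exists_norm_qFactorialInv_le {q : ℂ} (hq : ‖q‖ < 1) :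
    ∃ C, ∀ k, ‖qFactorialInv q k‖ ≤ C := by
  obtain ⟨C, hC⟩ := (Metric.isBounded_range_of_tendsto _
    ((tendsto_qFactorial hq).inv₀ (tprod_one_sub_pow_succ_ne_zero hq))).exists_norm_le
  refine ⟨C, fun k ↦ ?_⟩
  rw [qFactorialInv]
  split_ifs
  · exact hC _ ⟨_, rfl⟩
  · simpa using (norm_nonneg _).trans (hC _ ⟨0, rfl⟩)

/-- The finite form of the Jacobi triple product identity. -/
lemma hasSum_finite_jacobi_triple_product {a b : ℂ} (ha : a ≠ 0) (hb : b ≠ 0)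
    (hab : ‖a * b‖ < 1) (n : ℕ) :
    HasSum (fun m : ℤ ↦ qFactorial (a * b) (2 * n) * qFactorialInv (a * b) (n + m) *
        qFactorialInv (a * b) (n - m) * ramanujanThetaTerm a b m)
      ((∏ i ∈ range n, (1 + a * (a * b) ^ i)) * ∏ i ∈ range n, (1 + b * (a * b) ^ i)) := by
  induction n with
  | zero =>
    convert hasSum_single (0 : ℤ) ?_ using 1
    · simp [qFactorial, qFactorialInv, ramanujanThetaTerm]
    · intro m hm
      rcases hm.lt_or_gt with h | h <;> simp [qFactorialInv, h.not_ge]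
  | succ n ih =>
    have hab₀ : a * b ≠ 0 := mul_ne_zero ha hb
    have h := ((ih.mul_left (1 + a * b * (a * b) ^ (2 * n))).add
      (((Equiv.subRight (1 : ℤ)).hasSum_iff.mpr ih).mul_left (a * (a * b) ^ n))).add
      (((Equiv.addRight (1 : ℤ)).hasSum_iff.mpr ih).mul_left (b * (a * b) ^ n))
    have hprod (P Q : ℂ) : P * (1 + a * (a * b) ^ n) * (Q * (1 + b * (a * b) ^ n)) =
        (1 + a * b * (a * b) ^ (2 * n)) * (P * Q) + a * (a * b) ^ n * (P * Q) +
          b * (a * b) ^ n * (P * Q) := by ring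
    rw [prod_range_succ, prod_range_succ, hprod]
    refine (congrArg (HasSum · _) (funext fun m ↦ ?_)).mpr h
    simp only [Function.comp_apply, Equiv.coe_addRight, Equiv.subRight_apply]
    have hR (k : ℤ) : qFactorialInv (a * b) k =
        (1 - a * b * (a * b) ^ k) * qFactorialInv (a * b) (k + 1) := by
      simpa [zpow_add_one₀ hab₀, mul_comm] using qFactorialInv_sub_one hab (k + 1)
    have hR' (k : ℤ) := qFactorialInv_sub_one hab k
    have ht := ramanujanThetaTerm_add_one ha hb (m - 1)
    rw [sub_add_cancel] at ht
    have hx : (a * b) ^ ((n : ℤ) + m) = (a * b) ^ n * (a * b) ^ m := by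
      rw [zpow_add₀ hab₀, zpow_natCast]
    have hy : (a * b) ^ ((n : ℤ) - m) * (a * b) ^ m = (a * b) ^ n := by
      rw [← zpow_add₀ hab₀, sub_add_cancel, zpow_natCast]
    have hm : (a * b) ^ m = (a * b) ^ (m - 1) * (a * b) := by
      rw [← zpow_add_one₀ hab₀, sub_add_cancel]
    have hxy : (a * b) ^ (2 * n) = (a * b) ^ ((n : ℤ) + m) * (a * b) ^ ((n : ℤ) - m) := by
      rw [hx, mul_assoc, mul_comm (_ ^ m), hy]; ring
    have h₁ : a * (a * b) ^ n * ramanujanThetaTerm a b (m - 1) =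
        a * b * (a * b) ^ ((n : ℤ) - m) * ramanujanThetaTerm a b m := by
      rw [ht, ← hy, hm]; ring
    have h₂ : b * (a * b) ^ n * ramanujanThetaTerm a b (m + 1) =
        a * b * (a * b) ^ ((n : ℤ) + m) * ramanujanThetaTerm a b m := by
      rw [ramanujanThetaTerm_add_one ha hb, hx]; ring
    have e₁ : qFactorialInv (a * b) (n + (m - 1)) = (1 - (a * b) ^ ((n : ℤ) + m)) *
        qFactorialInv (a * b) (n + m) := by rw [← hR']; ring_nf
    have e₂ : qFactorialInv (a * b) (n - (m + 1)) = (1 - (a * b) ^ ((n : ℤ) - m)) *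
        qFactorialInv (a * b) (n - m) := by rw [← hR']; ring_nf
    rw [e₁, e₂, hR (n + m), hR (n - m), show 2 * (n + 1) = 2 * n + 1 + 1 by ring,
      qFactorial_succ, qFactorial_succ, pow_succ _ (2 * n + 1), pow_succ _ (2 * n), hxy,
      show (n : ℤ) - (m - 1) = n - m + 1 by ring, show (n : ℤ) + (m + 1) = n + m + 1 by ring,
      show ((n + 1 : ℕ) : ℤ) + m = n + m + 1 by push_cast; ring,
      show ((n + 1 : ℕ) : ℤ) - m = n - m + 1 by push_cast; ring]
    generalize (a * b) ^ ((n : ℤ) + m) = x at *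
    generalize (a * b) ^ ((n : ℤ) - m) = y at *
    generalize qFactorialInv (a * b) (n + m + 1) = A
    generalize qFactorialInv (a * b) (n - m + 1) = B
    generalize qFactorial (a * b) (2 * n) = E
    linear_combination (-E * A * B * (1 - x) * (1 - a * b * x)) * h₁ -
      E * A * B * (1 - y) * (1 - a * b * y) * h₂

lemma tendsto_prod_range_one_add_mul_pow {q : ℂ} (hq : ‖q‖ < 1) (a : ℂ) :
    Tendsto (fun n ↦ ∏ i ∈ range n, (1 + a * q ^ i)) atTop (𝓝 (∏' n : ℕ, (1 + a * q ^ n))) := by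
  refine (multipliable_one_add_of_summable ?_).hasProd.tendsto_prod_nat
  simpa using (summable_geometric_of_lt_one (norm_nonneg _) hq).mul_left ‖a‖


/-- Product representation of the **Ramanujan general theta function**
`f(a,b) = ∑_{m∈ℤ} a^{m(m+1)/2} b^{m(m−1)/2}`: for nonzero complex `a, b` with
`|ab| < 1`,
`f(a,b) = (−a;ab)_∞ (−b;ab)_∞ (ab;ab)_∞`, i.e.
`f(a,b) = ∏_{n=0}^∞ (1+a(ab)^n) · ∏_{n=0}^∞ (1+b(ab)^n) · ∏_{n=1}^∞ (1−(ab)^n)`. -/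
theorem ramanujan_theta_product (a b : ℂ) (ha : a ≠ 0) (hb : b ≠ 0)
    (hab : ‖a * b‖ < 1) :
    ∑' m : ℤ, a ^ (m * (m + 1) / 2) * b ^ (m * (m - 1) / 2) =
      (∏' n : ℕ, (1 + a * (a * b) ^ n)) * (∏' n : ℕ, (1 + b * (a * b) ^ n)) *
        ∏' n : ℕ, (1 - (a * b) ^ (n + 1)) := by
  obtain ⟨C, hC⟩ := exists_norm_qFactorial_le hab
  obtain ⟨D, hD⟩ := exists_norm_qFactorialInv_le hab
  have hC₀ : 0 ≤ C := (norm_nonneg _).trans (hC 0)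
  have hD₀ : 0 ≤ D := (norm_nonneg _).trans (hD 0)
  have hL := tprod_one_sub_pow_succ_ne_zero hab
  set L := ∏' n : ℕ, (1 - (a * b) ^ (n + 1))
  have hsum := tendsto_tsum_of_dominated_convergence
    (f := fun (n : ℕ) (m : ℤ) ↦ qFactorial (a * b) (2 * n) * qFactorialInv (a * b) (n + m) *
      qFactorialInv (a * b) (n - m) * ramanujanThetaTerm a b m)
    (g := fun m ↦ L * L⁻¹ * L⁻¹ * ramanujanThetaTerm a b m) (𝓕 := atTop)
    ((summable_ramanujanThetaTerm ha hb hab).norm.mul_left (C * D * D))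
    (fun m ↦ by
      refine Tendsto.mul_const _ (((tendsto_qFactorial hab).comp
        (tendsto_id.const_mul_atTop' two_pos)).mul
        ((tendsto_qFactorialInv hab).comp ?_) |>.mul ((tendsto_qFactorialInv hab).comp ?_))
      · exact tendsto_atTop_add_const_right _ m tendsto_natCast_atTop_atTop
      · exact tendsto_atTop_add_const_right _ (-m) tendsto_natCast_atTop_atTop)
    (.of_forall fun n m ↦ by
      rw [norm_mul, norm_mul, norm_mul]
      gcongr
      exacts [hC _, hD _, hD _])
  simp_rw [(hasSum_finite_jacobi_triple_product ha hb hab _).tsum_eq] at hsum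
  have h := tendsto_nhds_unique hsum ((tendsto_prod_range_one_add_mul_pow hab a).mul
    (tendsto_prod_range_one_add_mul_pow hab b))
  rw [tsum_mul_left, mul_inv_cancel₀ hL, one_mul] at h
  rw [← h, mul_comm, mul_inv_cancel_left₀ hL]
  rfl
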